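/- arXiv:1305.6402 — 3 statements merged into one kernel-verified Lean document; each statement's English description precedes it below -/
import Mathlib

section
/- Let A be a real n×n matrix, B a real n×m matrix, and C_v a real q×n matrix. Define the PI-augmented matrices Ā = [[A, 0],[C_v, I_q]] (size (n+q)×(n+q)) and B̄ = [[B],[0]] (size (n+q)×m), viewed as complex matrices. Then the Hautus controllability condition rank [λI_{n+q} − Ā, B̄] = n+q holds for all λ ∈ ℂ if and only if (i) rank [λI_n − A, B] = n for all λ ∈ ℂ, and (ii) rank of the block matrix [[A − I_n, B],[C_v, 0]] equals n+q. -/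
open Matrix

lemma rank_full_iff {K ι κ : Type*} [Field K] [Fintype ι] [Fintype κ]
    (M : Matrix ι κ K) :
    M.rank = Fintype.card ι ↔ ∀ w : ι → K, w ᵥ* M = 0 → w = 0 := by
  rw [Matrix.rank_eq_finrank_span_row, eq_comm]
  change Fintype.card ι = (Set.range M.row).finrank K ↔ _
  rw [← linearIndependent_iff_card_eq_finrank_span, ← Matrix.vecMul_injective_iff]
  exact injective_iff_map_eq_zero (Matrix.vecMulLinear M)

lemma full_complexify {ι κ : Type*} [Fintype ι] (M : Matrix ι κ ℝ) :
    (∀ w : ι → ℝ, w ᵥ* M = 0 → w = 0) ↔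
      ∀ w : ι → ℂ, w ᵥ* M.map Complex.ofReal = 0 → w = 0 := by
  constructor
  · intro h w hw
    have h1 := h (fun i => (w i).re) (by
      ext j
      have := congrArg Complex.re (congrFun hw j)
      simpa [Matrix.vecMul, dotProduct] using this)
    have h2 := h (fun i => (w i).im) (by
      ext j
      have := congrArg Complex.im (congrFun hw j)
      simpa [Matrix.vecMul, dotProduct] using this)
    ext i
    exact Complex.ext (congrFun h1 i) (congrFun h2 i)
  · intro h w hw
    have h1 := h (fun i => (w i : ℂ)) (by
      ext j
      have := congrArg Complex.ofReal (congrFun hw j)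
      simpa [Matrix.vecMul, dotProduct] using this)
    ext i
    simpa using congrFun h1 i

lemma elim_vecMul_aug {n m q : ℕ} (A : Matrix (Fin n) (Fin n) ℂ)
    (B : Matrix (Fin n) (Fin m) ℂ) (C : Matrix (Fin q) (Fin n) ℂ) (lam : ℂ)
    (x : Fin n → ℂ) (y : Fin q → ℂ) :
    Sum.elim x y ᵥ* Matrix.fromCols (lam • (1 : Matrix (Fin n ⊕ Fin q) (Fin n ⊕ Fin q) ℂ) -
      Matrix.fromBlocks A 0 C 1) (Matrix.fromRows B 0) = 0 ↔
    x ᵥ* (lam • 1 - A) - y ᵥ* C = 0 ∧ (lam - 1) • y = 0 ∧ x ᵥ* B = 0 := by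
  have e : lam • (1 : Matrix (Fin n ⊕ Fin q) (Fin n ⊕ Fin q) ℂ) - Matrix.fromBlocks A 0 C 1
      = Matrix.fromBlocks (lam • 1 - A) 0 (-C) ((lam - 1) • 1) := by
    rw [← Matrix.fromBlocks_one, Matrix.fromBlocks_smul, sub_eq_add_neg, Matrix.fromBlocks_neg,
      Matrix.fromBlocks_add]
    simp [sub_eq_add_neg, add_smul]
  rw [e, Matrix.vecMul_fromCols, Matrix.vecMul_fromBlocks, Matrix.sumElim_vecMul_fromRows]
  have z : ∀ {α β : Type} (f : α → ℂ) (g : β → ℂ), Sum.elim f g = 0 ↔ f = 0 ∧ g = 0 := by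
    intro α β f g
    simp [funext_iff]
  rw [z, z]
  simp [Matrix.vecMul_neg, sub_eq_add_neg, Matrix.vecMul_smul, and_assoc]

theorem aug_core {n m q : ℕ} (A : Matrix (Fin n) (Fin n) ℂ)
    (B : Matrix (Fin n) (Fin m) ℂ) (C : Matrix (Fin q) (Fin n) ℂ) :
    (∀ lam : ℂ, ∀ w, w ᵥ* Matrix.fromCols
      (lam • (1 : Matrix (Fin n ⊕ Fin q) (Fin n ⊕ Fin q) ℂ) -
      Matrix.fromBlocks A 0 C 1) (Matrix.fromRows B 0) = 0 → w = 0) ↔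
    (∀ lam : ℂ, ∀ x, x ᵥ* Matrix.fromCols (lam • 1 - A) B = 0 → x = 0) ∧
    ∀ w, w ᵥ* Matrix.fromBlocks (A - 1) B C 0 = 0 → w = 0 := by
  have z : ∀ {α β : Type} (f : α → ℂ) (g : β → ℂ), Sum.elim f g = 0 ↔ f = 0 ∧ g = 0 := by
    intro α β f g
    simp [funext_iff]
  have s : ∀ {α β : Type} (P : (α ⊕ β → ℂ) → Prop), (∀ w, P w) ↔ ∀ x y, P (Sum.elim x y) := by
    intro α β P
    exact ⟨fun h x y => h _, fun h w => by
      rw [← Sum.elim_comp_inl_inr w]; exact h _ _⟩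
  simp only [s, elim_vecMul_aug]
  simp only [z, Matrix.vecMul_fromCols, Matrix.vecMul_fromBlocks,
    Sum.elim_comp_inl, Sum.elim_comp_inr, Matrix.vecMul_zero, add_zero]
  constructor
  · intro h
    refine ⟨fun lam x ⟨h1, h2⟩ => (h lam x 0 ⟨by simp [h1], by simp, h2⟩).1, ?_⟩
    rintro x y ⟨h1, h2⟩
    have := h 1 x (y) ⟨by
      rw [← neg_eq_zero, ← h1]
      simp only [Matrix.vecMul_sub, one_smul]
      abel, by simp, h2⟩
    exact this
  · rintro ⟨h1, h2⟩ lam x y ⟨h3, h4, h5⟩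
    by_cases hl : lam = 1
    · subst hl
      refine h2 x y ⟨?_, h5⟩
      rw [← neg_eq_zero, ← h3]
      simp only [Matrix.vecMul_sub, one_smul]
      abel
    · have hy : y = 0 := (smul_eq_zero.1 h4).resolve_left (sub_ne_zero.2 hl)
      subst hy
      exact ⟨h1 lam x ⟨by simpa using h3, h5⟩, rfl⟩



/-- The Hautus controllability condition for the PI-augmented pair
`(Ā, B̄)` with `Ā = [[A, 0],[C_v, I_q]]`, `B̄ = [[B],[0]]` holds for all `λ ∈ ℂ`
iff `(A,B)` is Hautus-controllable and `rank [[A − I, B],[C_v, 0]] = n + q`. -/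
theorem pi_augmented_hautus_controllability (n m q : ℕ)
    (A : Matrix (Fin n) (Fin n) ℝ) (B : Matrix (Fin n) (Fin m) ℝ)
    (Cv : Matrix (Fin q) (Fin n) ℝ) :
    (∀ lam : ℂ,
        (Matrix.fromCols
            (lam • (1 : Matrix (Fin n ⊕ Fin q) (Fin n ⊕ Fin q) ℂ) -
              (Matrix.fromBlocks A 0 Cv (1 : Matrix (Fin q) (Fin q) ℝ)).map
                Complex.ofReal)
            ((Matrix.fromRows B (0 : Matrix (Fin q) (Fin m) ℝ)).map
              Complex.ofReal)).rank = n + q) ↔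
      ((∀ lam : ℂ,
          (Matrix.fromCols
              (lam • (1 : Matrix (Fin n) (Fin n) ℂ) - A.map Complex.ofReal)
              (B.map Complex.ofReal)).rank = n) ∧
        (Matrix.fromBlocks (A - 1) B Cv (0 : Matrix (Fin q) (Fin m) ℝ)).rank
          = n + q) := by
  have c : n + q = Fintype.card (Fin n ⊕ Fin q) := by simp
  have c' : ∀ M : Matrix (Fin n) (Fin n ⊕ Fin m) ℂ, M.rank = n ↔ 
      ∀ w : Fin n → ℂ, w ᵥ* M = 0 → w = 0 := by
    intro M
    rw [← rank_full_iff, Fintype.card_fin]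
  have m1 : (Matrix.fromBlocks A 0 Cv (1 : Matrix (Fin q) (Fin q) ℝ)).map Complex.ofReal
      = Matrix.fromBlocks (A.map Complex.ofReal) 0 (Cv.map Complex.ofReal) 1 := by
    rw [Matrix.fromBlocks_map, Matrix.map_zero _ Complex.ofReal_zero,
      Matrix.map_one _ Complex.ofReal_zero Complex.ofReal_one]
  have m2 : (Matrix.fromRows B (0 : Matrix (Fin q) (Fin m) ℝ)).map Complex.ofReal
      = Matrix.fromRows (B.map Complex.ofReal) 0 := by
    ext (i | i) j <;> simp
  have m3 : (Matrix.fromBlocks (A - 1) B Cv (0 : Matrix (Fin q) (Fin m) ℝ)).map Complex.ofReal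
      = Matrix.fromBlocks (A.map Complex.ofReal - 1) (B.map Complex.ofReal)
        (Cv.map Complex.ofReal) 0 := by
    rw [Matrix.fromBlocks_map, Matrix.map_zero _ Complex.ofReal_zero,
      Matrix.map_sub _ Complex.ofReal_sub,
      Matrix.map_one _ Complex.ofReal_zero Complex.ofReal_one]
  simp only [c', c, rank_full_iff]
  rw [full_complexify, m1, m2, m3]
  exact aug_core _ _ _
end

section
/- Let A be a real n×n matrix, B a real n×m matrix, and C_v a real q×n matrix, and set Ā = [[A, 0],[C_v, I_q]], B̄ = [[B],[0]]. For every complex number λ ≠ 1, the rank of the complex matrix [λI_{n+q} − Ā, B̄] equals q + rank [λI_n − A, B]. -/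
open Matrix

/-- For `λ ≠ 1`, the rank of the Hautus matrix of the PI-augmented
pair `(Ā, B̄)` equals `q` plus the rank of the Hautus matrix of `(A, B)`. -/
theorem pi_augmented_hautus_rank_ne_one (n m q : ℕ)
    (A : Matrix (Fin n) (Fin n) ℝ) (B : Matrix (Fin n) (Fin m) ℝ)
    (Cv : Matrix (Fin q) (Fin n) ℝ)
    (lam : ℂ) (hlam : lam ≠ 1) :
    (Matrix.fromCols
        (lam • (1 : Matrix (Fin n ⊕ Fin q) (Fin n ⊕ Fin q) ℂ) -
          (Matrix.fromBlocks A 0 Cv (1 : Matrix (Fin q) (Fin q) ℝ)).map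
            Complex.ofReal)
        ((Matrix.fromRows B (0 : Matrix (Fin q) (Fin m) ℝ)).map
          Complex.ofReal)).rank =
      q + (Matrix.fromCols
            (lam • (1 : Matrix (Fin n) (Fin n) ℂ) - A.map Complex.ofReal)
            (B.map Complex.ofReal)).rank := by
  have hl : lam - 1 ≠ 0 := sub_ne_zero.mpr hlam
  set M := (Matrix.fromCols
        (lam • (1 : Matrix (Fin n ⊕ Fin q) (Fin n ⊕ Fin q) ℂ) -
          (Matrix.fromBlocks A 0 Cv (1 : Matrix (Fin q) (Fin q) ℝ)).map
            Complex.ofReal)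
        ((Matrix.fromRows B (0 : Matrix (Fin q) (Fin m) ℝ)).map
          Complex.ofReal)) with hM
  set N := (Matrix.fromCols
            (lam • (1 : Matrix (Fin n) (Fin n) ℂ) - A.map Complex.ofReal)
            (B.map Complex.ofReal)) with hN
  let e : Fin n ⊕ Fin m → (Fin n ⊕ Fin q) ⊕ Fin m := Sum.map Sum.inl id
  let f := LinearMap.funLeft ℂ ℂ e
  -- top block row
  have top : ∀ (v : (Fin n ⊕ Fin q) ⊕ Fin m → ℂ) (i : Fin n),
      (M *ᵥ v) (Sum.inl i) = (N *ᵥ (f v)) i := by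
    intro v i
    simp [hM, hN, Matrix.mulVec, dotProduct, Fintype.sum_sum_type, f, e, LinearMap.funLeft_apply,
      Matrix.one_apply]
  -- bottom block row
  have bot : ∀ (v : (Fin n ⊕ Fin q) ⊕ Fin m → ℂ) (j : Fin q),
      (M *ᵥ v) (Sum.inr j) =
        (lam - 1) * v (Sum.inl (Sum.inr j)) - ∑ i, (Cv j i : ℂ) * v (Sum.inl (Sum.inl i)) := by
    intro v j
    have h : ∀ x : Fin q, ((if j = x then lam else 0) -
        (((if j = x then (1 : ℝ) else 0) : ℝ) : ℂ)) * v (Sum.inl (Sum.inr x)) =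
        if j = x then (lam - 1) * v (Sum.inl (Sum.inr x)) else 0 := by
      intro x; split_ifs <;> simp
    simp [hM, Matrix.mulVec, dotProduct, Fintype.sum_sum_type, Matrix.one_apply, h]
    ring
  have hf : ∀ v ∈ LinearMap.ker M.mulVecLin, f v ∈ LinearMap.ker N.mulVecLin := by
    intro v hv
    rw [LinearMap.mem_ker, Matrix.mulVecLin_apply] at hv ⊢
    ext i
    rw [← top, hv]; rfl
  have hbij : Function.Bijective (f.restrict hf) := by
    constructor
    · rw [← LinearMap.ker_eq_bot, LinearMap.ker_eq_bot']
      rintro ⟨v, hv⟩ h0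
      have h0' : f v = 0 := congrArg Subtype.val h0
      have hx : ∀ i, v (Sum.inl (Sum.inl i)) = 0 := fun i => congrFun h0' (Sum.inl i)
      have hu : ∀ i, v (Sum.inr i) = 0 := fun i => congrFun h0' (Sum.inr i)
      rw [LinearMap.mem_ker, Matrix.mulVecLin_apply] at hv
      apply Subtype.ext
      funext k
      rcases k with (i | j) | i
      · exact hx i
      · have := bot v j
        rw [hv] at this
        simpa [hx, hl] using this
      · exact hu i
    · rintro ⟨w, hw⟩
      rw [LinearMap.mem_ker, Matrix.mulVecLin_apply] at hw
      let v : (Fin n ⊕ Fin q) ⊕ Fin m → ℂ :=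
        Sum.elim (Sum.elim (fun i => w (Sum.inl i))
          (fun j => (lam - 1)⁻¹ * ∑ i, (Cv j i : ℂ) * w (Sum.inl i))) (fun i => w (Sum.inr i))
      have hfv : f v = w := by
        funext k
        rcases k with i | i <;> rfl
      refine ⟨⟨v, ?_⟩, Subtype.ext hfv⟩
      rw [LinearMap.mem_ker, Matrix.mulVecLin_apply]
      funext k
      rcases k with i | j
      · rw [top, hfv, hw]; rfl
      · rw [bot]
        simp only [v, Sum.elim_inl, Sum.elim_inr, Pi.zero_apply]
        rw [mul_inv_cancel_left₀ hl, sub_self]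
  have hker := (LinearEquiv.ofBijective _ hbij).finrank_eq
  have h1 := LinearMap.finrank_range_add_finrank_ker M.mulVecLin
  have h2 := LinearMap.finrank_range_add_finrank_ker N.mulVecLin
  simp only [Module.finrank_fintype_fun_eq_card, Fintype.card_sum, Fintype.card_fin] at h1 h2
  unfold Matrix.rank
  omega
end

section
/- Let A be a real n×n matrix, C a real p×n matrix, and C_v a real q×n matrix, and set Ā = [[A, 0],[C_v, I_q]] and C̄ = [C, 0] (a p×(n+q) matrix). Assume the pair (A,C) is Hautus-observable, i.e. the stacked matrix [λI_n − A; C] has rank n for all λ ∈ ℂ. Then for every complex λ ≠ 1, the stacked matrix [λI_{n+q} − Ā; C̄] has rank n+q. -/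
open Matrix

lemma rank_eq_card_iff_ker {m k : Type*} [Fintype m] [Fintype k] (M : Matrix m k ℂ) :
    M.rank = Fintype.card k ↔ ∀ v, M *ᵥ v = 0 → v = 0 := by
  classical
  have h := LinearMap.finrank_range_add_finrank_ker M.mulVecLin
  rw [Module.finrank_fintype_fun_eq_card] at h
  have h2 : M.rank = Module.finrank ℂ (LinearMap.range M.mulVecLin) := rfl
  rw [← h2] at h
  have h3 : M.rank = Fintype.card k ↔ LinearMap.ker M.mulVecLin = ⊥ := by
    rw [← Submodule.finrank_eq_zero (R := ℂ)]
    omega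
  rw [h3, LinearMap.ker_eq_bot']
  rfl

/-- If `(A, C)` is Hautus-observable, then for every `λ ≠ 1` the
stacked Hautus matrix `[λI − Ā; C̄]` of the PI-augmented pair
`Ā = [[A,0],[C_v,I_q]]`, `C̄ = [C, 0]` has full rank `n + q`. -/
theorem pi_augmented_hautus_observability_ne_one (n p q : ℕ)
    (A : Matrix (Fin n) (Fin n) ℝ) (C : Matrix (Fin p) (Fin n) ℝ)
    (Cv : Matrix (Fin q) (Fin n) ℝ)
    (hobs : ∀ lam : ℂ,
      (Matrix.fromRows
          (lam • (1 : Matrix (Fin n) (Fin n) ℂ) - A.map Complex.ofReal)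
          (C.map Complex.ofReal)).rank = n)
    (lam : ℂ) (hlam : lam ≠ 1) :
    (Matrix.fromRows
        (lam • (1 : Matrix (Fin n ⊕ Fin q) (Fin n ⊕ Fin q) ℂ) -
          (Matrix.fromBlocks A 0 Cv (1 : Matrix (Fin q) (Fin q) ℝ)).map
            Complex.ofReal)
        ((Matrix.fromCols C (0 : Matrix (Fin p) (Fin q) ℝ)).map
          Complex.ofReal)).rank = n + q := by
  have key := (rank_eq_card_iff_ker _).1 ((hobs lam).trans (Fintype.card_fin n).symm)
  have hc : n + q = Fintype.card (Fin n ⊕ Fin q) := by simp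
  rw [hc, rank_eq_card_iff_ker]
  intro v hv
  obtain ⟨x, y, rfl⟩ : ∃ x y, v = Sum.elim x y :=
    ⟨v ∘ Sum.inl, v ∘ Sum.inr, (Sum.elim_comp_inl_inr v).symm⟩
  have e1 : (Matrix.fromBlocks A 0 Cv (1 : Matrix (Fin q) (Fin q) ℝ)).map Complex.ofReal
      = Matrix.fromBlocks (A.map Complex.ofReal) 0 (Cv.map Complex.ofReal) 1 := by
    rw [Matrix.fromBlocks_map, Matrix.map_zero _ Complex.ofReal_zero,
      Matrix.map_one _ Complex.ofReal_zero Complex.ofReal_one]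
  have e2 : (Matrix.fromCols C (0 : Matrix (Fin p) (Fin q) ℝ)).map Complex.ofReal
      = Matrix.fromCols (C.map Complex.ofReal) 0 := by
    ext i (j | j) <;> simp
  rw [e1, e2, fromRows_mulVec, sub_mulVec, smul_mulVec, one_mulVec, fromBlocks_mulVec,
    fromCols_mulVec_sumElim] at hv
  simp only [Sum.elim_comp_inl, Sum.elim_comp_inr, zero_mulVec, add_zero, one_mulVec] at hv
  have hx : x = 0 := by
    apply key
    rw [fromRows_mulVec, sub_mulVec, smul_mulVec, one_mulVec]
    ext (i | i)
    · simpa using congrFun hv (Sum.inl (Sum.inl i))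
    · simpa using congrFun hv (Sum.inr i)
  subst hx
  have hy : y = 0 := by
    ext i
    have h := congrFun hv (Sum.inl (Sum.inr i))
    simp at h
    have h' : (lam - 1) * y i = 0 := by linear_combination h
    exact (mul_eq_zero.1 h').resolve_left (sub_ne_zero.2 hlam)
  subst hy
  ext (i | i) <;> rfl
end
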